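/- Let N ≥ 3 be an odd integer and κ ∈ (0,1), and let G be the N×N matrix with entries G_{jk} = ψ_k(1, θ_j). Then the largest eigenvalue of the symmetric matrix Gᵀ·G equals N², and the smallest eigenvalue of Gᵀ·G equals (N²/4)·(1 + κ^{N−2})². -/

import Mathlib

open Matrix

/-- The DSM-QR basis function `ψ_k(s,θ)` (1-based index `k`): `ψ_1(s,θ) = √N` and, for
`m = 1,…,(N−1)/2`, `ψ_{2m}(s,θ) = √(N/2)(s^m sin(mθ) − κ^{N−2m} s^{N−m} sin((N−m)θ))`,
`ψ_{2m+1}(s,θ) = √(N/2)(s^m cos(mθ) + κ^{N−2m} s^{N−m} cos((N−m)θ))`. -/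
noncomputable def psi (N : ℕ) (κ : ℝ) (k : ℕ) (s θ : ℝ) : ℝ :=
  if k = 1 then Real.sqrt N
  else if k % 2 = 0 then
    Real.sqrt ((N : ℝ) / 2) *
      (s ^ (k / 2) * Real.sin ((k / 2 : ℕ) * θ) -
        κ ^ (N - 2 * (k / 2)) * s ^ (N - k / 2) * Real.sin (((N - k / 2 : ℕ) : ℝ) * θ))
  else
    Real.sqrt ((N : ℝ) / 2) *
      (s ^ (k / 2) * Real.cos ((k / 2 : ℕ) * θ) +
        κ ^ (N - 2 * (k / 2)) * s ^ (N - k / 2) * Real.cos (((N - k / 2 : ℕ) : ℝ) * θ))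

/-- The collocation angle `θ_j = 2πj/N`. -/
noncomputable def theta (N : ℕ) (j : ℕ) : ℝ := 2 * Real.pi * j / N

/-- The DSM-QR collocation matrix `G`, with `G_{jk} = ψ_k(1, θ_j)` (1-based `j,k`). -/
noncomputable def Gmat (N : ℕ) (κ : ℝ) : Matrix (Fin N) (Fin N) ℝ := fun j k =>
  psi N κ (k.val + 1) 1 (theta N (j.val + 1))

theorem sum_exp_theta (N : ℕ) (hN : N ≠ 0) (p : ℤ) :
    ∑ j : Fin N, Complex.exp (((p * theta N (j.val + 1) : ℝ) : ℂ) * Complex.I) =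
      if (N : ℤ) ∣ p then (N : ℂ) else 0 := by
  have hζ := Complex.isPrimitiveRoot_exp N hN
  set ζ := Complex.exp (2 * Real.pi * Complex.I / N) with hζdef
  have hterm (j : ℕ) : Complex.exp (((p * theta N (j + 1) : ℝ) : ℂ) * Complex.I) =
      ζ ^ p * (ζ ^ p) ^ j := by
    rw [← pow_succ', hζdef, ← Complex.exp_int_mul, ← Complex.exp_nat_mul]
    congr 1
    simp only [theta]
    push_cast
    ring
  simp only [hterm]
  rw [Fin.sum_univ_eq_sum_range (fun j => ζ ^ p * (ζ ^ p) ^ j), ← Finset.mul_sum]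
  split_ifs with h
  · rw [(hζ.zpow_eq_one_iff_dvd p).2 h]
    simp
  · have hne : ζ ^ p ≠ 1 := fun h1 => h ((hζ.zpow_eq_one_iff_dvd p).1 h1)
    have hpow : (ζ ^ p) ^ N = 1 := by
      rw [← zpow_natCast, ← _root_.zpow_mul, mul_comm, _root_.zpow_mul, zpow_natCast, hζ.pow_eq_one,
        _root_.one_zpow]
    rw [geom_sum_eq hne, hpow]
    simp

theorem sum_cos_theta (N : ℕ) (hN : N ≠ 0) (p : ℤ) :
    ∑ j : Fin N, Real.cos (p * theta N (j.val + 1)) = if (N : ℤ) ∣ p then (N : ℝ) else 0 := by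
  have h := congrArg Complex.re (sum_exp_theta N hN p)
  simp only [Complex.re_sum, Complex.exp_ofReal_mul_I_re] at h
  rw [h]
  split_ifs <;> simp

theorem sum_sin_theta (N : ℕ) (hN : N ≠ 0) (p : ℤ) :
    ∑ j : Fin N, Real.sin (p * theta N (j.val + 1)) = 0 := by
  have h := congrArg Complex.im (sum_exp_theta N hN p)
  simp only [Complex.im_sum, Complex.exp_ofReal_mul_I_im] at h
  rw [h]
  split_ifs <;> simp

theorem sum_cos_mul_cos_theta (N : ℕ) (hN : N ≠ 0) (m n : ℕ) (hmn : m + n < N) :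
    ∑ j : Fin N, Real.cos (m * theta N (j.val + 1)) * Real.cos (n * theta N (j.val + 1)) =
      if m = n then (if m = 0 then (N : ℝ) else N / 2) else 0 := by
  have h (x : ℝ) : Real.cos (m * x) * Real.cos (n * x) =
      (Real.cos (((m - n : ℤ) : ℝ) * x) + Real.cos (((m + n : ℤ) : ℝ) * x)) / 2 := by
    push_cast
    rw [sub_mul, add_mul, Real.cos_sub, Real.cos_add]
    ring
  simp only [h]
  rw [← Finset.sum_div, Finset.sum_add_distrib, sum_cos_theta N hN, sum_cos_theta N hN]
  have h1 : (N : ℤ) ∣ (m - n : ℤ) ↔ m = n := by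
    refine ⟨fun hd => ?_, fun hd => by simp [hd]⟩
    have := Int.eq_zero_of_abs_lt_dvd hd (by rw [abs_lt]; omega)
    omega
  have h2 : (N : ℤ) ∣ (m + n : ℤ) ↔ m = 0 ∧ n = 0 := by
    refine ⟨fun hd => ?_, fun hd => by simp [hd]⟩
    have := Int.eq_zero_of_abs_lt_dvd hd (by rw [abs_lt]; omega)
    omega
  simp only [h1, h2]
  split_ifs <;> first | omega | ring

theorem sum_sin_mul_sin_theta (N : ℕ) (hN : N ≠ 0) (m n : ℕ) (hmn : m + n < N) (hm : m ≠ 0) :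
    ∑ j : Fin N, Real.sin (m * theta N (j.val + 1)) * Real.sin (n * theta N (j.val + 1)) =
      if m = n then (N : ℝ) / 2 else 0 := by
  have h (x : ℝ) : Real.sin (m * x) * Real.sin (n * x) =
      Real.cos (((m - n : ℤ) : ℝ) * x) - Real.cos (m * x) * Real.cos (n * x) := by
    push_cast
    rw [sub_mul, Real.cos_sub]
    ring
  simp only [h]
  rw [Finset.sum_sub_distrib, sum_cos_theta N hN, sum_cos_mul_cos_theta N hN m n hmn]
  have h1 : (N : ℤ) ∣ (m - n : ℤ) ↔ m = n := by
    refine ⟨fun hd => ?_, fun hd => by simp [hd]⟩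
    have := Int.eq_zero_of_abs_lt_dvd hd (by rw [abs_lt]; omega)
    omega
  simp only [h1, hm, if_false]
  split_ifs <;> ring

theorem sum_sin_mul_cos_theta (N : ℕ) (hN : N ≠ 0) (m n : ℕ) :
    ∑ j : Fin N, Real.sin (m * theta N (j.val + 1)) * Real.cos (n * theta N (j.val + 1)) = 0 := by
  have h (x : ℝ) : Real.sin (m * x) * Real.cos (n * x) =
      (Real.sin (((m - n : ℤ) : ℝ) * x) + Real.sin (((m + n : ℤ) : ℝ) * x)) / 2 := by
    push_cast
    rw [sub_mul, add_mul, Real.sin_sub, Real.sin_add]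
    ring
  simp only [h]
  rw [← Finset.sum_div, Finset.sum_add_distrib, sum_sin_theta N hN, sum_sin_theta N hN]
  simp

theorem sub_mul_theta (N : ℕ) (hN : N ≠ 0) (m j : ℕ) (hm : m ≤ N) :
    ((N - m : ℕ) : ℝ) * theta N j = j * (2 * Real.pi) - m * theta N j := by
  have : (N : ℝ) ≠ 0 := by exact_mod_cast hN
  rw [Nat.cast_sub hm, theta]
  field_simp

/-- The common amplitude of the entries in a column of `Gmat N κ` (0-based column index). -/
noncomputable def columnCoeff (N : ℕ) (κ : ℝ) (k : ℕ) : ℝ :=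
  if k = 0 then Real.sqrt N
  else Real.sqrt ((N : ℝ) / 2) * (1 + κ ^ (N - 2 * ((k + 1) / 2)))

/-- The diagonal entries of `(Gmat N κ)ᵀ * Gmat N κ` (0-based index). -/
noncomputable def gramDiag (N : ℕ) (κ : ℝ) (k : ℕ) : ℝ :=
  if k = 0 then (N : ℝ) ^ 2
  else (N : ℝ) ^ 2 / 4 * (1 + κ ^ (N - 2 * ((k + 1) / 2))) ^ 2

theorem Gmat_apply (N : ℕ) (κ : ℝ) (j k : Fin N) :
    Gmat N κ j k = columnCoeff N κ k.val *
      (if k.val % 2 = 1 then Real.sin (((k.val + 1) / 2 : ℕ) * theta N (j.val + 1))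
        else Real.cos (((k.val + 1) / 2 : ℕ) * theta N (j.val + 1))) := by
  have hN : N ≠ 0 := by have := k.isLt; omega
  have hm : (k.val + 1) / 2 ≤ N := by have := k.isLt; omega
  unfold Gmat psi columnCoeff
  rw [sub_mul_theta N hN _ _ hm, Real.sin_nat_mul_two_pi_sub, Real.cos_nat_mul_two_pi_sub]
  by_cases h0 : k.val = 0
  · simp [h0]
  · by_cases h1 : k.val % 2 = 1
    · have h2 : (k.val + 1) % 2 = 0 := by omega
      simp only [h0, h1, h2, Nat.add_eq_right, if_true, if_false, one_pow]
      ring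
    · have h2 : ¬ (k.val + 1) % 2 = 0 := by omega
      simp only [h0, h1, h2, Nat.add_eq_right, if_false, one_pow]
      ring

theorem Gmat_transpose_mul_self (N : ℕ) (hN : Odd N) (κ : ℝ) :
    (Gmat N κ)ᵀ * Gmat N κ = Matrix.diagonal fun k : Fin N => gramDiag N κ k.val := by
  have hN2 : N % 2 = 1 := Nat.odd_iff.1 hN
  have hN0 : N ≠ 0 := by omega
  ext k l
  have hk := k.isLt
  have hl := l.isLt
  rw [Matrix.mul_apply, Matrix.diagonal_apply]
  simp only [Matrix.transpose_apply, Gmat_apply, mul_mul_mul_comm (columnCoeff N κ k.val)]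
  rw [← Finset.mul_sum]
  have hsum : (k.val + 1) / 2 + (l.val + 1) / 2 < N := by omega
  have hsq : Real.sqrt N * Real.sqrt N = N := Real.mul_self_sqrt (by positivity)
  have hsq2 : Real.sqrt ((N : ℝ) / 2) * Real.sqrt ((N : ℝ) / 2) = N / 2 :=
    Real.mul_self_sqrt (by positivity)
  by_cases hkl : k = l
  · subst hkl
    simp only [if_true]
    by_cases h1 : k.val % 2 = 1
    · have h0 : k.val ≠ 0 := by omega
      simp only [h1, if_true]
      rw [sum_sin_mul_sin_theta N hN0 _ _ hsum (by omega)]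
      simp only [columnCoeff, gramDiag, h0, if_true, if_false]
      linear_combination (1 + κ ^ (N - 2 * ((k.val + 1) / 2))) ^ 2 * (N / 2) * hsq2
    · simp only [h1, if_false]
      rw [sum_cos_mul_cos_theta N hN0 _ _ hsum]
      by_cases h0 : k.val = 0
      · simp only [columnCoeff, gramDiag, h0, if_true]
        norm_num
        ring
      · have h2 : (k.val + 1) / 2 ≠ 0 := by omega
        simp only [columnCoeff, gramDiag, h0, h2, if_true, if_false]
        linear_combination (1 + κ ^ (N - 2 * ((k.val + 1) / 2))) ^ 2 * (N / 2) * hsq2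
  · have hne : k.val ≠ l.val := fun h => hkl (Fin.ext h)
    rw [if_neg hkl]
    refine mul_eq_zero_of_right _ ?_
    by_cases h1 : k.val % 2 = 1 <;> by_cases h2 : l.val % 2 = 1 <;>
      simp only [h1, h2, if_true, if_false]
    · rw [sum_sin_mul_sin_theta N hN0 _ _ hsum (by omega), if_neg (by omega)]
    · exact sum_sin_mul_cos_theta N hN0 _ _
    · simp only [mul_comm (Real.cos _)]
      exact sum_sin_mul_cos_theta N hN0 _ _
    · rw [sum_cos_mul_cos_theta N hN0 _ _ hsum, if_neg (by omega)]

theorem gramDiag_le (N : ℕ) (κ : ℝ) (hκ0 : 0 ≤ κ) (hκ1 : κ ≤ 1) (k : ℕ) :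
    gramDiag N κ k ≤ (N : ℝ) ^ 2 := by
  unfold gramDiag
  split_ifs
  · rfl
  · have h0 := pow_nonneg hκ0 (N - 2 * ((k + 1) / 2))
    have h1 : κ ^ (N - 2 * ((k + 1) / 2)) ≤ 1 := pow_le_one₀ hκ0 hκ1
    have h4 : (1 + κ ^ (N - 2 * ((k + 1) / 2))) ^ 2 ≤ 4 := by nlinarith
    nlinarith [mul_le_mul_of_nonneg_left h4 (sq_nonneg (N : ℝ))]

theorem le_gramDiag (N : ℕ) (κ : ℝ) (hκ0 : 0 ≤ κ) (hκ1 : κ ≤ 1) (k : ℕ) :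
    (N : ℝ) ^ 2 / 4 * (1 + κ ^ (N - 2)) ^ 2 ≤ gramDiag N κ k := by
  by_cases hk : k = 0
  · have h := gramDiag_le N κ hκ0 hκ1 1
    simpa [gramDiag, hk] using h
  · have h : κ ^ (N - 2) ≤ κ ^ (N - 2 * ((k + 1) / 2)) :=
      pow_le_pow_of_le_one hκ0 hκ1 (by omega)
    have h0 := pow_nonneg hκ0 (N - 2)
    simp only [gramDiag, hk, if_false]
    gcongr

theorem GtG_extreme_eigenvalues (N : ℕ) (hNodd : Odd N) (hN3 : 3 ≤ N)
    (κ : ℝ) (hκ : κ ∈ Set.Ioo (0 : ℝ) 1) :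
    IsGreatest (spectrum ℝ ((Gmat N κ)ᵀ * Gmat N κ)) ((N : ℝ) ^ 2) ∧
    IsLeast (spectrum ℝ ((Gmat N κ)ᵀ * Gmat N κ)) ((N : ℝ) ^ 2 / 4 * (1 + κ ^ (N - 2)) ^ 2) := by
  rw [Gmat_transpose_mul_self N hNodd κ, spectrum_diagonal]
  refine ⟨⟨⟨⟨0, by omega⟩, by simp [gramDiag]⟩, ?_⟩, ⟨⟨⟨1, by omega⟩, by simp [gramDiag]⟩, ?_⟩⟩
  · rintro _ ⟨k, rfl⟩
    exact gramDiag_le N κ hκ.1.le hκ.2.le k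
  · rintro _ ⟨k, rfl⟩
    exact le_gramDiag N κ hκ.1.le hκ.2.le k
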